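/- arXiv:2207.09218 — 2 statements merged into one kernel-verified Lean document; each statement's English description precedes it below -/
import Mathlib

section
/- Define D := 2 + ∫₀¹ G_x(1,t) b̂(t) dt + ∫₀¹ G_x(0,t) ( b̂(t) + ĉ(t) + d ∫₀¹ G(t,s) b̂(s) ds ) dt. Then there exist constants C > 0 and ε₀ > 0, depending only on b, c, d, such that for every ε ∈ (0, ε₀] it holds D ≥ C/ε. (In fact D = (b + d e^{−c/b})/ε + O(1) as ε → 0.) -/
open Set

theorem eq_mul_exp_of_hasDerivAt {f : ℝ → ℝ} {k : ℝ} (hf : ∀ x, HasDerivAt f (k * f x) x)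
    (a x : ℝ) : f x = f a * Real.exp (k * (x - a)) := by
  have hg : ∀ y, HasDerivAt (fun y => f y * Real.exp (-(k * (y - a)))) 0 y := fun y => by
    have he : HasDerivAt (fun y : ℝ => -(k * (y - a))) (-(k * 1)) y :=
      (((hasDerivAt_id' y).sub_const a).const_mul k).neg
    refine ((hf y).mul he.exp).congr_deriv ?_
    ring
  have hconst := is_const_of_deriv_eq_zero (fun y => (hg y).differentiableAt)
    (fun y => (hg y).deriv) x a
  simp only [sub_self, mul_zero, neg_zero, Real.exp_zero, mul_one, Real.exp_neg] at hconst
  rw [← hconst, inv_mul_cancel_right₀ (Real.exp_ne_zero _)]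

/-- `v` is a solution, with derivative `v'`, of `-ε v'' - b v' + c v = 0`. -/
structure IsHomSol (ε b c : ℝ) (v v' : ℝ → ℝ) : Prop where
  hasDerivAt : ∀ x, HasDerivAt v (v' x) x
  hasDerivAt' : ∀ x, HasDerivAt v' ((c * v x - b * v' x) / ε) x

namespace IsHomSol

variable {ε b c : ℝ} {v v' v₁ v₁' v₂ v₂' : ℝ → ℝ}

theorem of_contDiff (hε : ε ≠ 0) (hv : ContDiff ℝ 2 v)
    (h : ∀ x, -ε * deriv (deriv v) x - b * deriv v x + c * v x = 0) :
    IsHomSol ε b c v (deriv v) where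
  hasDerivAt x := (hv.differentiable (by norm_num) x).hasDerivAt
  hasDerivAt' x := by
    have h1 : ContDiff ℝ 1 (deriv v) :=
      (contDiff_succ_iff_deriv (n := 1).1 (by simpa [one_add_one_eq_two] using hv)).2.2
    have h2 := (h1.differentiable (by norm_num) x).hasDerivAt
    refine h2.congr_deriv ?_
    rw [eq_div_iff hε]
    linarith [h x]

theorem continuous (h : IsHomSol ε b c v v') : Continuous v :=
  continuous_iff_continuousAt.2 fun x => (h.hasDerivAt x).continuousAt

/-- If `r, s` are the roots of the characteristic equation, then `v' - s v` is an exponential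
with rate `r`. -/
theorem deriv_sub_mul_eq (h : IsHomSol ε b c v v') {r s : ℝ} (hsum : r + s = -(b / ε))
    (hprod : r * s = -(c / ε)) (a x : ℝ) :
    v' x - s * v x = (v' a - s * v a) * Real.exp (r * (x - a)) := by
  refine eq_mul_exp_of_hasDerivAt (f := fun x => v' x - s * v x) (fun y => ?_) a x
  refine ((h.hasDerivAt' y).sub ((h.hasDerivAt y).const_mul s)).congr_deriv ?_
  linear_combination v y * hprod - v' y * hsum

theorem strictMono_mul_exp (h : IsHomSol ε b c v v') {s : ℝ}
    (hpos : ∀ x, 0 < v' x - s * v x) : StrictMono fun x => v x * Real.exp (-s * x) := by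
  refine strictMono_of_hasDerivAt_pos
    (f' := fun x => (v' x - s * v x) * Real.exp (-s * x)) (fun x => ?_)
    fun x => mul_pos (hpos x) (Real.exp_pos _)
  refine ((h.hasDerivAt x).mul ((hasDerivAt_id' x).const_mul (-s)).exp).congr_deriv ?_
  ring

/-- If the Wronskian of `v` and `y` is divided by a Wronskian `w` of two homogeneous solutions,
its derivative is `-f v / (ε w)`, where `f` is the image of `y` under the operator. -/
theorem hasDerivAt_wronskian_div (h : IsHomSol ε b c v v') (hε : ε ≠ 0) {y w : ℝ → ℝ}
    {y' f x : ℝ} (hw : HasDerivAt w (-(b / ε) * w x) x) (hwx : w x ≠ 0)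
    (hy : HasDerivAt y y' x) (hf : f = -b * y' + c * y x) :
    HasDerivAt (fun t => (v t * y' - v' t * y t) / w t) (-(v x * f / (ε * w x))) x := by
  refine ((((h.hasDerivAt x).mul_const y').sub ((h.hasDerivAt' x).mul hy)).div hw hwx).congr_deriv
    ?_
  simp only [Pi.sub_apply, Pi.mul_apply]
  field_simp
  rw [hf]
  ring

theorem integral_mul_div (h : IsHomSol ε b c v v') (hε : ε ≠ 0) {w : ℝ → ℝ}
    (hw : ∀ x, HasDerivAt w (-(b / ε) * w x) x) (hw0 : ∀ x, w x ≠ 0) (m n α β : ℝ) :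
    ∫ t in α..β, v t * (-b * m + c * (m * t + n)) / (ε * w t) =
      (v α * m - v' α * (m * α + n)) / w α - (v β * m - v' β * (m * β + n)) / w β := by
  have hwc : Continuous w := continuous_iff_continuousAt.2 fun x => (hw x).continuousAt
  have hvc := h.continuous
  have hderiv : ∀ x ∈ uIcc α β,
      HasDerivAt (fun t => -((v t * m - v' t * (m * t + n)) / w t))
        (v x * (-b * m + c * (m * x + n)) / (ε * w x)) x := fun x _ => by
    have hy : HasDerivAt (fun t => m * t + n) m x := by
      simpa using ((hasDerivAt_id' x).const_mul m).add_const n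
    exact (h.hasDerivAt_wronskian_div hε (hw x) (hw0 x) hy rfl).neg.congr_deriv (neg_neg _)
  rw [intervalIntegral.integral_eq_sub_of_hasDerivAt hderiv]
  · ring
  · refine Continuous.intervalIntegrable ?_ _ _
    exact Continuous.div (by fun_prop) (by fun_prop) fun x => mul_ne_zero hε (hw0 x)

theorem hasDerivAt_wronskian (h₁ : IsHomSol ε b c v₁ v₁') (h₂ : IsHomSol ε b c v₂ v₂') (x : ℝ) :
    HasDerivAt (fun x => v₁ x * v₂' x - v₁' x * v₂ x)
      (-(b / ε) * (v₁ x * v₂' x - v₁' x * v₂ x)) x := by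
  refine (((h₁.hasDerivAt x).mul (h₂.hasDerivAt' x)).sub
    ((h₁.hasDerivAt' x).mul (h₂.hasDerivAt x))).congr_deriv ?_
  ring

end IsHomSol

theorem exists_characteristic_roots {ε b c : ℝ} (hε : 0 < ε) (hb : 0 < b) (hc : 0 < c) :
    ∃ lam > 0, ∃ μ, b / ε ≤ μ ∧ lam + -μ = -(b / ε) ∧ lam * -μ = -(c / ε) := by
  have hs : 0 ≤ b ^ 2 + 4 * ε * c := by positivity
  have hsq := Real.sq_sqrt hs
  have hlt : b < √(b ^ 2 + 4 * ε * c) := Real.lt_sqrt_of_sq_lt (by nlinarith [mul_pos hε hc])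
  set S := √(b ^ 2 + 4 * ε * c)
  refine ⟨(S - b) / (2 * ε), div_pos (by linarith) (by positivity), (S + b) / (2 * ε), ?_, ?_, ?_⟩
  · rw [div_le_div_iff₀ hε (by positivity)]
    nlinarith
  · field_simp
    ring
  · field_simp
    nlinarith

/-- Lower bound for the denominator
`D = 2 + ∫₀¹ G_x(1,t) b̂(t) dt + ∫₀¹ G_x(0,t)(b̂(t) + ĉ(t) + d ∫₀¹ G(t,s) b̂(s) ds) dt`,
where `b̂(t) = b − c t` and `ĉ(t) = c + d t`: there exist `C > 0` and `ε₀ > 0`, depending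
only on `b, c, d`, such that `D ≥ C/ε` for every `ε ∈ (0, ε₀]`. -/
theorem green_function_denominator_bound (b c d : ℝ) (hb : 0 < b) (hc : 0 < c)
    (hd : 0 < d) :
    ∃ C > (0:ℝ), ∃ ε₀ > (0:ℝ), ∀ ε ∈ Set.Ioc (0:ℝ) ε₀,
      ∀ v₁ v₂ w : ℝ → ℝ, ∀ G : ℝ → ℝ → ℝ,
        ContDiff ℝ 2 v₁ → ContDiff ℝ 2 v₂ →
        (∀ x, -ε * deriv (deriv v₁) x - b * deriv v₁ x + c * v₁ x = 0) →
        v₁ 0 = 0 → deriv v₁ 0 = 1 →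
        (∀ x, -ε * deriv (deriv v₂) x - b * deriv v₂ x + c * v₂ x = 0) →
        v₂ 1 = 0 → deriv v₂ 1 = 1 →
        (w = fun x => v₁ x * deriv v₂ x - deriv v₁ x * v₂ x) →
        (∀ x ∈ Icc (0:ℝ) 1, w x ≠ 0) →
        (G = fun x t =>
          if x ≤ t then -(v₁ x * v₂ t) / (ε * w t) else -(v₁ t * v₂ x) / (ε * w t)) →
        C / ε ≤
          2 + (∫ t in (0:ℝ)..1, deriv (fun y => G y t) 1 * (b - c * t)) +
            ∫ t in (0:ℝ)..1, deriv (fun y => G y t) 0 *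
              ((b - c * t) + (c + d * t) +
                d * ∫ s in (0:ℝ)..1, G t s * (b - c * s)) := by
  refine ⟨b, hb, 1, one_pos, ?_⟩
  rintro ε ⟨hε, -⟩ v₁ v₂ w G hv₁ hv₂ hode₁ hv₁0 hv₁'0 hode₂ hv₂1 hv₂'1 hw - hG
  have hε0 := hε.ne'
  have h₁ := IsHomSol.of_contDiff hε0 hv₁ hode₁
  have h₂ := IsHomSol.of_contDiff hε0 hv₂ hode₂
  set v₁' := deriv v₁
  set v₂' := deriv v₂
  obtain ⟨lam, hlam, μ, hμ, hsum, hprod⟩ := exists_characteristic_roots hε hb hc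
  have hμ0 : 0 < μ := (div_pos hb hε).trans_le hμ
  have hsum' : -μ + lam = -(b / ε) := by linarith
  have hprod' : -μ * lam = -(c / ε) := by linarith
  have hv₁pos : ∀ x, 0 < x → 0 < v₁ x := fun x hx => by
    have hmono := h₁.strictMono_mul_exp (s := -μ) fun x => by
      rw [h₁.deriv_sub_mul_eq hsum hprod 0 x, hv₁0, hv₁'0]; simp [Real.exp_pos]
    have := hmono hx
    simp only [hv₁0, zero_mul] at this
    exact pos_of_mul_pos_left this (Real.exp_pos _).le
  have hv₁'pos : 0 < v₁' 1 := by
    have h := h₁.deriv_sub_mul_eq hsum' hprod' 0 1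
    rw [hv₁0, hv₁'0] at h
    have := mul_pos hlam (hv₁pos 1 one_pos)
    have := Real.exp_pos (-μ * (1 - 0))
    linarith
  have hv₂neg : ∀ x, x < 1 → v₂ x < 0 := fun x hx => by
    have hmono := h₂.strictMono_mul_exp (s := lam) fun x => by
      rw [h₂.deriv_sub_mul_eq hsum' hprod' 1 x, hv₂1, hv₂'1]; simp [Real.exp_pos]
    have := hmono hx
    simp only [hv₂1, zero_mul] at this
    exact neg_of_mul_neg_left this (Real.exp_pos _).le
  have hv₂'0 : -μ * v₂ 0 < v₂' 0 := by
    have h := h₂.deriv_sub_mul_eq hsum hprod 1 0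
    rw [hv₂1, hv₂'1] at h
    have := Real.exp_pos (lam * (0 - 1))
    linarith
  have hwd : ∀ x, HasDerivAt w (-(b / ε) * w x) x := by
    subst hw
    exact h₁.hasDerivAt_wronskian h₂
  have hw_zero : w 0 = -v₂ 0 := by simp [hw, hv₁0, hv₁'0]
  have hw_one : w 1 = v₁ 1 := by simp [hw, hv₂1, hv₂'1]
  have hwpos : ∀ x, 0 < w x := fun x => by
    rw [eq_mul_exp_of_hasDerivAt hwd 0 x, hw_zero]
    exact mul_pos (by linarith [hv₂neg 0 one_pos]) (Real.exp_pos _)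
  have hwne : ∀ x, w x ≠ 0 := fun x => (hwpos x).ne'
  have hwc : Continuous w := continuous_iff_continuousAt.2 fun x => (hwd x).continuousAt
  have hv₁c := h₁.continuous
  have hv₂c := h₂.continuous
  have hv₁1 := hv₁pos 1 one_pos
  have hv₂0 := hv₂neg 0 one_pos
  have hG_le : ∀ {x t}, x ≤ t → G x t = -(v₁ x * v₂ t) / (ε * w t) := fun h => by
    simp [hG, h]
  have hG_ge : ∀ {x t}, t < x → G x t = -(v₁ t * v₂ x) / (ε * w t) := fun h => by
    simp [hG, h.not_ge]
  have hsol : ∀ x ∈ Ioo (0:ℝ) 1,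
      ∫ s in (0:ℝ)..1, G x s * (b - c * s) = v₁ x / v₁ 1 - x := by
    intro x hx
    have e₁ : EqOn (fun s => -v₂ x * (v₁ s * (-b * (-1) + c * (-1 * s + 0)) / (ε * w s)))
        (fun s => G x s * (b - c * s)) (Ioo 0 x) := fun s hs => by
      simp only [hG_ge hs.2]; ring
    have e₂ : EqOn (fun s => -v₁ x * (v₂ s * (-b * (-1) + c * (-1 * s + 0)) / (ε * w s)))
        (fun s => G x s * (b - c * s)) (Ioo x 1) := fun s hs => by
      simp only [hG_le hs.1.le]; ring
    have cont : ∀ (k : ℝ) {v : ℝ → ℝ}, Continuous v → Continuous fun s =>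
        k * (v s * (-b * (-1) + c * (-1 * s + 0)) / (ε * w s)) := fun k v hv =>
      continuous_const.mul
        (Continuous.div (by fun_prop) (by fun_prop) fun s => mul_ne_zero hε0 (hwne s))
    have i₁ := ((cont (-v₂ x) hv₁c).intervalIntegrable (μ := MeasureTheory.volume) 0 x).congr_uIoo
      (by rwa [uIoo_of_le hx.1.le])
    have i₂ := ((cont (-v₁ x) hv₂c).intervalIntegrable (μ := MeasureTheory.volume) x 1).congr_uIoo
      (by rwa [uIoo_of_le hx.2.le])
    rw [← intervalIntegral.integral_add_adjacent_intervals i₁ i₂,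
      ← intervalIntegral.integral_congr_Ioo_of_le hx.1.le e₁,
      ← intervalIntegral.integral_congr_Ioo_of_le hx.2.le e₂,
      intervalIntegral.integral_const_mul, intervalIntegral.integral_const_mul,
      h₁.integral_mul_div hε0 hwd hwne, h₂.integral_mul_div hε0 hwd hwne,
      hv₁0, hv₂1, hv₂'1, hw_one]
    have hwx := hwne x
    have hwx' : w x = v₁ x * v₂' x - v₁' x * v₂ x := by rw [hw]
    field_simp
    rw [hwx']
    ring
  have hI₁ : ∫ t in (0:ℝ)..1, deriv (fun y => G y t) 1 * (b - c * t) = v₁' 1 / v₁ 1 - 1 := by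
    have e : EqOn (fun t => deriv (fun y => G y t) 1 * (b - c * t))
        (fun t => -1 * (v₁ t * (-b * (-1) + c * (-1 * t + 0)) / (ε * w t))) (Ioo 0 1) := by
      intro t ht
      have hd1 : deriv (fun y => G y t) 1 = -(v₁ t * v₂' 1) / (ε * w t) := by
        refine HasDerivAt.deriv ?_
        refine (((h₂.hasDerivAt 1).const_mul (v₁ t)).neg.div_const (ε * w t)).congr_of_eventuallyEq
          ?_
        filter_upwards [lt_mem_nhds ht.2] with y hy using hG_ge hy
      simp only [hd1, hv₂'1]; ring
    rw [intervalIntegral.integral_congr_Ioo_of_le zero_le_one e, intervalIntegral.integral_const_mul,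
      h₁.integral_mul_div hε0 hwd hwne, hv₁0, hw_one]
    field_simp
    ring
  have hI₂ : -1 - v₂' 0 / v₂ 0 ≤ ∫ t in (0:ℝ)..1, deriv (fun y => G y t) 0 *
      ((b - c * t) + (c + d * t) + d * ∫ s in (0:ℝ)..1, G t s * (b - c * s)) := by
    have e : EqOn (fun t => deriv (fun y => G y t) 0 *
          ((b - c * t) + (c + d * t) + d * ∫ s in (0:ℝ)..1, G t s * (b - c * s)))
        (fun t => -1 * (v₂ t * (-b * (-1) + c * (-1 * t + 1)) / (ε * w t)) +
          d * (-v₂ t * v₁ t / (v₁ 1 * (ε * w t)))) (Ioo 0 1) := by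
      intro t ht
      have hd0 : deriv (fun y => G y t) 0 = -(v₁' 0 * v₂ t) / (ε * w t) := by
        refine HasDerivAt.deriv ?_
        refine (((h₁.hasDerivAt 0).mul_const (v₂ t)).neg.div_const (ε * w t)).congr_of_eventuallyEq
          ?_
        filter_upwards [gt_mem_nhds ht.1] with y hy using hG_le (le_of_lt hy)
      have hwt := hwne t
      simp only [hd0, hv₁'0, hsol t ht]
      field_simp
      ring
    have hc₁ : Continuous fun t => v₂ t * (-b * (-1) + c * (-1 * t + 1)) / (ε * w t) :=
      Continuous.div (by fun_prop) (by fun_prop) fun s => mul_ne_zero hε0 (hwne s)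
    have hc₂ : Continuous fun t => -v₂ t * v₁ t / (v₁ 1 * (ε * w t)) :=
      Continuous.div (by fun_prop) (by fun_prop)
        fun s => mul_ne_zero hv₁1.ne' (mul_ne_zero hε0 (hwne s))
    have hnonneg : 0 ≤ ∫ t in (0:ℝ)..1, -v₂ t * v₁ t / (v₁ 1 * (ε * w t)) := by
      refine intervalIntegral.integral_nonneg zero_le_one fun t ht => ?_
      have hv₂t : v₂ t ≤ 0 := by
        rcases ht.2.eq_or_lt with rfl | h
        exacts [hv₂1.le, (hv₂neg t h).le]
      have hv₁t : 0 ≤ v₁ t := by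
        rcases ht.1.eq_or_lt with rfl | h
        exacts [hv₁0.ge, (hv₁pos t h).le]
      have := hwpos t
      exact div_nonneg (mul_nonneg (by linarith) hv₁t) (by positivity)
    rw [intervalIntegral.integral_congr_Ioo_of_le zero_le_one e,
      intervalIntegral.integral_add ((hc₁.const_mul _).intervalIntegrable _ _)
        ((hc₂.const_mul _).intervalIntegrable _ _),
      intervalIntegral.integral_const_mul, intervalIntegral.integral_const_mul,
      h₂.integral_mul_div hε0 hwd hwne, hv₂1, hv₂'1, hw_zero]
    refine le_add_of_le_of_nonneg (le_of_eq ?_) (mul_nonneg hd.le hnonneg)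
    have := hv₂0.ne
    field_simp
    ring
  have hμ_le : μ ≤ -(v₂' 0 / v₂ 0) := by
    rw [← div_neg, le_div_iff₀ (by linarith)]
    linarith
  have := div_pos hv₁'pos hv₁1
  linarith
end

section
/- Define N := β − δ + ∫₀¹ G_x(0,t) ( f(t+1) − δ ĉ(t) + (β − δ) b̂(t) − d ∫₀¹ G(t,s) f(s) ds ) dt − ∫₀¹ G_x(1,t) f(t) dt. Then there exist constants C > 0 and ε₀ > 0, depending only on b, c, d, such that for every ε ∈ (0, ε₀], every continuous f : [0,2] → ℝ and all β, δ ∈ ℝ it holds |N| ≤ C ( |β| + |δ| + ( |β| + |δ| + ‖f‖_{L^∞(0,2)} ) / ε ). -/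
open Set

section SolutionBounds

variable {b c ε : ℝ} {v v' : ℝ → ℝ}

lemma hasDerivAt_exp_mul_const_div (b ε x : ℝ) :
    HasDerivAt (fun y : ℝ => Real.exp (b * y / ε)) (Real.exp (b * x / ε) * (b / ε)) x := by
  have h := (((hasDerivAt_id x).const_mul b).div_const ε).exp
  simpa using h

/-- `exp (b x / ε) v v'` is nondecreasing for solutions of the ODE. -/
lemma monotone_exp_mul_self_mul_deriv (hc : 0 < c) (hε : 0 < ε)
    (hv : ∀ x, HasDerivAt v (v' x) x)
    (hv' : ∀ x, HasDerivAt v' ((c * v x - b * v' x) / ε) x) :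
    Monotone fun x => Real.exp (b * x / ε) * (v x * v' x) := by
  refine monotone_of_hasDerivAt_nonneg
    (fun x => (hasDerivAt_exp_mul_const_div b ε x).mul ((hv x).mul (hv' x))) fun x => ?_
  have h : Real.exp (b * x / ε) * (b / ε) * (v x * v' x) + Real.exp (b * x / ε) *
      (v' x * v' x + v x * ((c * v x - b * v' x) / ε)) =
      Real.exp (b * x / ε) * (v' x ^ 2 + c / ε * v x ^ 2) := by
    field_simp
    ring
  simp only [Pi.zero_apply]
  rw [h]
  positivity

/-- `exp (b x / ε) v (ε v' + b v)` is nondecreasing for solutions of the ODE. -/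
lemma monotone_exp_mul_self_mul_flux (hc : 0 < c) (hε : 0 < ε)
    (hv : ∀ x, HasDerivAt v (v' x) x)
    (hv' : ∀ x, HasDerivAt v' ((c * v x - b * v' x) / ε) x) :
    Monotone fun x => Real.exp (b * x / ε) * (v x * (ε * v' x + b * v x)) := by
  refine monotone_of_hasDerivAt_nonneg
    (fun x => (hasDerivAt_exp_mul_const_div b ε x).mul
      ((hv x).mul (((hv' x).const_mul ε).add ((hv x).const_mul b)))) fun x => ?_
  have h : Real.exp (b * x / ε) * (b / ε) * (v x * (ε * v' x + b * v x)) +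
      Real.exp (b * x / ε) * (v' x * (ε * v' x + b * v x) +
        v x * (ε * ((c * v x - b * v' x) / ε) + b * v' x)) =
      Real.exp (b * x / ε) * ((ε * v' x + b * v x) ^ 2 / ε + c * v x ^ 2) := by
    field_simp
    ring
  simp only [Pi.zero_apply]
  rw [h]
  positivity

lemma self_mul_deriv_nonneg (hc : 0 < c) (hε : 0 < ε)
    (hv : ∀ x, HasDerivAt v (v' x) x)
    (hv' : ∀ x, HasDerivAt v' ((c * v x - b * v' x) / ε) x) {a x : ℝ} (ha : v a = 0)
    (hx : a ≤ x) : 0 ≤ v x * v' x := by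
  have h := monotone_exp_mul_self_mul_deriv hc hε hv hv' hx
  simp only [ha, zero_mul, mul_zero] at h
  exact nonneg_of_mul_nonneg_right h (Real.exp_pos _)

lemma self_mul_deriv_nonpos (hc : 0 < c) (hε : 0 < ε)
    (hv : ∀ x, HasDerivAt v (v' x) x)
    (hv' : ∀ x, HasDerivAt v' ((c * v x - b * v' x) / ε) x) {a x : ℝ} (ha : v a = 0)
    (hx : x ≤ a) : v x * v' x ≤ 0 := by
  have h := monotone_exp_mul_self_mul_deriv hc hε hv hv' hx
  simp only [ha, zero_mul, mul_zero] at h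
  exact nonpos_of_mul_nonpos_right h (Real.exp_pos _)

lemma self_mul_flux_nonpos (hc : 0 < c) (hε : 0 < ε)
    (hv : ∀ x, HasDerivAt v (v' x) x)
    (hv' : ∀ x, HasDerivAt v' ((c * v x - b * v' x) / ε) x) {a x : ℝ} (ha : v a = 0)
    (hx : x ≤ a) : v x * (ε * v' x + b * v x) ≤ 0 := by
  have h := monotone_exp_mul_self_mul_flux hc hε hv hv' hx
  simp only [ha, zero_mul, mul_zero] at h
  exact nonpos_of_mul_nonpos_right h (Real.exp_pos _)

lemma abs_le_abs_of_zero_left (hc : 0 < c) (hε : 0 < ε)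
    (hv : ∀ x, HasDerivAt v (v' x) x)
    (hv' : ∀ x, HasDerivAt v' ((c * v x - b * v' x) / ε) x) {a x y : ℝ} (ha : v a = 0)
    (hx : a ≤ x) (hxy : x ≤ y) : |v x| ≤ |v y| := by
  have hd : ∀ z, HasDerivAt (fun z => v z * v z) (v' z * v z + v z * v' z) z :=
    fun z => (hv z).mul (hv z)
  have hm : MonotoneOn (fun z => v z * v z) (Ici a) := by
    refine monotoneOn_of_deriv_nonneg (convex_Ici a)
      (fun z _ => (hd z).continuousAt.continuousWithinAt)
      (fun z _ => (hd z).differentiableAt.differentiableWithinAt) fun z hz => ?_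
    rw [interior_Ici] at hz
    rw [(hd z).deriv]
    linarith [self_mul_deriv_nonneg hc hε hv hv' ha (le_of_lt hz), mul_comm (v z) (v' z)]
  exact abs_le_iff_mul_self_le.2 (hm hx (hx.trans hxy) hxy)

lemma abs_le_abs_of_zero_right (hc : 0 < c) (hε : 0 < ε)
    (hv : ∀ x, HasDerivAt v (v' x) x)
    (hv' : ∀ x, HasDerivAt v' ((c * v x - b * v' x) / ε) x) {a x y : ℝ} (ha : v a = 0)
    (hy : y ≤ a) (hxy : x ≤ y) : |v y| ≤ |v x| := by
  have hd : ∀ z, HasDerivAt (fun z => v z * v z) (v' z * v z + v z * v' z) z :=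
    fun z => (hv z).mul (hv z)
  have hm : AntitoneOn (fun z => v z * v z) (Iic a) := by
    refine antitoneOn_of_deriv_nonpos (convex_Iic a)
      (fun z _ => (hd z).continuousAt.continuousWithinAt)
      (fun z _ => (hd z).differentiableAt.differentiableWithinAt) fun z hz => ?_
    rw [interior_Iic] at hz
    rw [(hd z).deriv]
    linarith [self_mul_deriv_nonpos hc hε hv hv' ha (le_of_lt hz), mul_comm (v z) (v' z)]
  exact abs_le_iff_mul_self_le.2 (hm (hxy.trans hy) hy hxy)

lemma exp_mul_abs_le_of_zero_right (hc : 0 < c) (hε : 0 < ε)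
    (hv : ∀ x, HasDerivAt v (v' x) x)
    (hv' : ∀ x, HasDerivAt v' ((c * v x - b * v' x) / ε) x) {a x y : ℝ} (ha : v a = 0)
    (hy : y ≤ a) (hxy : x ≤ y) :
    |Real.exp (b * y / ε) * v y| ≤ |Real.exp (b * x / ε) * v x| := by
  have hu := fun z => (hasDerivAt_exp_mul_const_div b ε z).mul (hv z)
  have hd := fun z => (hu z).mul (hu z)
  have hm : AntitoneOn
      (fun z => (Real.exp (b * z / ε) * v z) * (Real.exp (b * z / ε) * v z)) (Iic a) := by
    refine antitoneOn_of_deriv_nonpos (convex_Iic a)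
      (fun z _ => (hd z).continuousAt.continuousWithinAt)
      (fun z _ => (hd z).differentiableAt.differentiableWithinAt) fun z hz => ?_
    rw [interior_Iic] at hz
    refine (hd z).deriv.trans_le ?_
    have h := self_mul_flux_nonpos hc hε hv hv' ha (le_of_lt hz)
    have hpos : 0 ≤ 2 * Real.exp (b * z / ε) ^ 2 / ε := by positivity
    have hle := mul_nonpos_of_nonneg_of_nonpos hpos h
    refine le_of_eq_of_le ?_ hle
    simp only [Pi.mul_apply]
    field_simp
    ring
  exact abs_le_iff_mul_self_le.2 (hm (hxy.trans hy) hy hxy)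

lemma exp_mul_wronskian_eq {u u' : ℝ → ℝ} (hε : 0 < ε)
    (hv : ∀ x, HasDerivAt v (v' x) x)
    (hv' : ∀ x, HasDerivAt v' ((c * v x - b * v' x) / ε) x)
    (hu : ∀ x, HasDerivAt u (u' x) x)
    (hu' : ∀ x, HasDerivAt u' ((c * u x - b * u' x) / ε) x) (x y : ℝ) :
    Real.exp (b * x / ε) * (v x * u' x - v' x * u x) =
      Real.exp (b * y / ε) * (v y * u' y - v' y * u y) := by
  have hd := fun z => (hasDerivAt_exp_mul_const_div b ε z).mul
    (((hv z).mul (hu' z)).sub ((hv' z).mul (hu z)))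
  refine is_const_of_deriv_eq_zero (fun z => (hd z).differentiableAt) (fun z => ?_) x y
  refine (hd z).deriv.trans ?_
  simp only [Pi.mul_apply, Pi.sub_apply]
  field_simp
  ring

lemma mul_abs_mul_le_abs_wronskian {u u' : ℝ → ℝ} (hc : 0 < c) (hε : 0 < ε)
    (hv : ∀ x, HasDerivAt v (v' x) x)
    (hv' : ∀ x, HasDerivAt v' ((c * v x - b * v' x) / ε) x)
    (hu : ∀ x, HasDerivAt u (u' x) x)
    (hu' : ∀ x, HasDerivAt u' ((c * u x - b * u' x) / ε) x) {p q x : ℝ}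
    (hp : v p = 0) (hq : u q = 0) (hpx : p ≤ x) (hxq : x ≤ q) :
    b * |v x * u x| ≤ ε * |v x * u' x - v' x * u x| := by
  have h1 := self_mul_deriv_nonneg hc hε hv hv' hp hpx
  have h2 := self_mul_flux_nonpos hc hε hu hu' hq hxq
  rcases eq_or_ne (v x * u x) 0 with h0 | h0
  · rw [h0, abs_zero, mul_zero]
    positivity
  · have hpos : 0 < |v x * u x| := abs_pos.2 h0
    refine le_of_mul_le_mul_right ?_ hpos
    have h3 : ε * ((v x * u' x - v' x * u x) * (v x * u x)) ≤ -(b * (v x * u x) ^ 2) := by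
      nlinarith [mul_nonneg (sq_nonneg (v x)) (neg_nonneg.2 h2),
        mul_nonneg (mul_nonneg hε.le h1) (sq_nonneg (u x))]
    have h4 := neg_abs_le ((v x * u' x - v' x * u x) * (v x * u x))
    rw [abs_mul] at h4
    rw [← sq_abs (v x * u x)] at h3
    nlinarith [mul_le_mul_of_nonneg_left h4 hε.le]

end SolutionBounds

/-- The Green's function assembled from `v₁`, `v₂` and the weight `w`. -/
noncomputable def greenKernel (ε : ℝ) (v₁ v₂ w : ℝ → ℝ) (x t : ℝ) : ℝ :=
  if x ≤ t then -(v₁ x * v₂ t) / (ε * w t) else -(v₁ t * v₂ x) / (ε * w t)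

lemma deriv_greenKernel_of_lt {ε x t : ℝ} {v₁ v₂ w : ℝ → ℝ} (h : x < t) :
    deriv (fun y => greenKernel ε v₁ v₂ w y t) x = -(deriv v₁ x * v₂ t) / (ε * w t) := by
  have he : (fun y => greenKernel ε v₁ v₂ w y t) =ᶠ[nhds x]
      fun y => -(v₁ y * v₂ t) / (ε * w t) := by
    filter_upwards [Iio_mem_nhds h] with y hy
    exact if_pos (le_of_lt hy)
  rw [he.deriv_eq, deriv_div_const, deriv.fun_neg, deriv_mul_const_field]

lemma deriv_greenKernel_of_gt {ε x t : ℝ} {v₁ v₂ w : ℝ → ℝ} (h : t < x) :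
    deriv (fun y => greenKernel ε v₁ v₂ w y t) x = -(v₁ t * deriv v₂ x) / (ε * w t) := by
  have he : (fun y => greenKernel ε v₁ v₂ w y t) =ᶠ[nhds x]
      fun y => -(v₁ t * v₂ y) / (ε * w t) := by
    filter_upwards [Ioi_mem_nhds h] with y hy
    exact if_neg (not_le_of_gt hy)
  rw [he.deriv_eq, deriv_div_const, deriv.fun_neg, deriv_const_mul_field]

/-- Upper bound for the numerator
`N = β − δ + ∫₀¹ G_x(0,t)(f(t+1) − δ ĉ(t) + (β−δ) b̂(t) − d ∫₀¹ G(t,s) f(s) ds) dt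
   − ∫₀¹ G_x(1,t) f(t) dt`, where `b̂(t) = b − c t` and `ĉ(t) = c + d t`: there exist
`C > 0` and `ε₀ > 0`, depending only on `b, c, d`, such that
`|N| ≤ C (|β| + |δ| + (|β| + |δ| + ‖f‖_{L^∞(0,2)})/ε)` for every `ε ∈ (0, ε₀]`, every
continuous `f` and all `β, δ`. -/
theorem green_function_numerator_bound (b c d : ℝ) (hb : 0 < b) (hc : 0 < c)
    (hd : 0 < d) :
    ∃ C > (0:ℝ), ∃ ε₀ > (0:ℝ), ∀ ε ∈ Set.Ioc (0:ℝ) ε₀,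
      ∀ v₁ v₂ w : ℝ → ℝ, ∀ G : ℝ → ℝ → ℝ,
        ContDiff ℝ 2 v₁ → ContDiff ℝ 2 v₂ →
        (∀ x, -ε * deriv (deriv v₁) x - b * deriv v₁ x + c * v₁ x = 0) →
        v₁ 0 = 0 → deriv v₁ 0 = 1 →
        (∀ x, -ε * deriv (deriv v₂) x - b * deriv v₂ x + c * v₂ x = 0) →
        v₂ 1 = 0 → deriv v₂ 1 = 1 →
        (w = fun x => v₁ x * deriv v₂ x - deriv v₁ x * v₂ x) →
        (∀ x ∈ Icc (0:ℝ) 1, w x ≠ 0) →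
        (G = fun x t =>
          if x ≤ t then -(v₁ x * v₂ t) / (ε * w t) else -(v₁ t * v₂ x) / (ε * w t)) →
        ∀ f : ℝ → ℝ, ContinuousOn f (Icc 0 2) → ∀ β δ : ℝ,
          |β - δ +
              (∫ t in (0:ℝ)..1, deriv (fun y => G y t) 0 *
                (f (t + 1) - δ * (c + d * t) + (β - δ) * (b - c * t) -
                  d * ∫ s in (0:ℝ)..1, G t s * f s)) -
              ∫ t in (0:ℝ)..1, deriv (fun y => G y t) 1 * f t| ≤
            C * (|β| + |δ| +
              (|β| + |δ| + ⨆ t : Icc (0:ℝ) 2, |f t|) / ε) := by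
  refine ⟨3 + b + 2 * c + d + d / b, by positivity, 1, one_pos, ?_⟩
  rintro ε ⟨hε, -⟩ v₁ v₂ w G hv₁ hv₂ hode₁ h₁0 h₁d hode₂ h₂1 h₂d hw hw0 hG f hf β δ
  have hD₁ : ∀ x, HasDerivAt v₁ (deriv v₁ x) x := fun x =>
    (hv₁.differentiable (by norm_num) x).hasDerivAt
  have hD₂ : ∀ x, HasDerivAt v₂ (deriv v₂ x) x := fun x =>
    (hv₂.differentiable (by norm_num) x).hasDerivAt
  have hD₁' : ∀ x, HasDerivAt (deriv v₁) ((c * v₁ x - b * deriv v₁ x) / ε) x := fun x => by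
    have h := ((hv₁.differentiable_deriv_two) x).hasDerivAt
    rwa [show deriv (deriv v₁) x = (c * v₁ x - b * deriv v₁ x) / ε by
      rw [eq_div_iff hε.ne']; linarith [hode₁ x]] at h
  have hD₂' : ∀ x, HasDerivAt (deriv v₂) ((c * v₂ x - b * deriv v₂ x) / ε) x := fun x => by
    have h := ((hv₂.differentiable_deriv_two) x).hasDerivAt
    rwa [show deriv (deriv v₂) x = (c * v₂ x - b * deriv v₂ x) / ε by
      rw [eq_div_iff hε.ne']; linarith [hode₂ x]] at h
  have hwx : ∀ x, w x = v₁ x * deriv v₂ x - deriv v₁ x * v₂ x := fun x => by rw [hw]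
  have hwc : ∀ x y, Real.exp (b * x / ε) * w x = Real.exp (b * y / ε) * w y := fun x y => by
    rw [hwx, hwx]
    exact exp_mul_wronskian_eq hε hD₁ hD₁' hD₂ hD₂' x y
  have hv₂w : ∀ t ∈ Icc (0:ℝ) 1, |v₂ t| ≤ |w t| := fun t ht => by
    have h := exp_mul_abs_le_of_zero_right hc hε hD₂ hD₂' h₂1 ht.2 ht.1
    have h0 : Real.exp (b * 0 / ε) * v₂ 0 = -(Real.exp (b * t / ε) * w t) := by
      rw [hwc t 0, hwx, h₁0, h₁d]
      ring
    rw [h0, abs_neg, abs_mul, abs_mul] at h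
    exact le_of_mul_le_mul_left h (abs_pos.2 (Real.exp_pos _).ne')
  have hv₁w : ∀ t ∈ Icc (0:ℝ) 1, |v₁ t| ≤ |w t| := fun t ht => by
    refine (abs_le_abs_of_zero_left hc hε hD₁ hD₁' h₁0 ht.1 ht.2).trans ?_
    have h1 : w 1 = v₁ 1 := by rw [hwx, h₂1, h₂d]; ring
    have h := congrArg abs (hwc t 1)
    rw [h1, abs_mul, abs_mul, Real.abs_exp, Real.abs_exp] at h
    have hexp : Real.exp (b * t / ε) ≤ Real.exp (b * 1 / ε) := by
      have := ht.2
      gcongr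
    refine le_of_mul_le_mul_left ?_ (Real.exp_pos (b * 1 / ε))
    rw [← h]
    gcongr
  have hGk : G = greenKernel ε v₁ v₂ w := hG
  have hwpos : ∀ t ∈ Icc (0:ℝ) 1, 0 < |w t| := fun t ht => abs_pos.2 (hw0 t ht)
  have hG0 : ∀ t ∈ Ioc (0:ℝ) 1, |deriv (fun y => G y t) 0| ≤ 1 / ε := fun t ht => by
    have ht' : t ∈ Icc (0:ℝ) 1 := Ioc_subset_Icc_self ht
    have := hwpos t ht'
    rw [hGk, deriv_greenKernel_of_lt ht.1, h₁d, one_mul, abs_div, abs_neg, abs_mul,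
      abs_of_pos hε, div_le_div_iff₀ (by positivity) hε]
    nlinarith [hv₂w t ht']
  have hG1 : ∀ t ∈ Ioo (0:ℝ) 1, |deriv (fun y => G y t) 1| ≤ 1 / ε := fun t ht => by
    have ht' : t ∈ Icc (0:ℝ) 1 := Ioo_subset_Icc_self ht
    have := hwpos t ht'
    rw [hGk, deriv_greenKernel_of_gt ht.2, h₂d, mul_one, abs_div, abs_neg, abs_mul,
      abs_of_pos hε, div_le_div_iff₀ (by positivity) hε]
    nlinarith [hv₁w t ht']
  have hGb : ∀ t ∈ Icc (0:ℝ) 1, ∀ s ∈ Icc (0:ℝ) 1, |G t s| ≤ 1 / b := fun t ht s hs => by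
    have hdiag : b * (|v₁ s| * |v₂ s|) ≤ ε * |w s| := by
      rw [← abs_mul, hwx]
      exact mul_abs_mul_le_abs_wronskian hc hε hD₁ hD₁' hD₂ hD₂' h₁0 h₂1 hs.1 hs.2
    have := hwpos s hs
    rw [hGk, greenKernel]
    split_ifs with h
    · have hle := abs_le_abs_of_zero_left hc hε hD₁ hD₁' h₁0 ht.1 h
      rw [abs_div, abs_neg, abs_mul, abs_mul, abs_of_pos hε,
        div_le_div_iff₀ (by positivity) hb]
      nlinarith [mul_le_mul_of_nonneg_left
        (mul_le_mul_of_nonneg_right hle (abs_nonneg (v₂ s))) hb.le]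
    · have hle := abs_le_abs_of_zero_right hc hε hD₂ hD₂' h₂1 ht.2 (le_of_not_ge h)
      rw [abs_div, abs_neg, abs_mul, abs_mul, abs_of_pos hε,
        div_le_div_iff₀ (by positivity) hb]
      nlinarith [mul_le_mul_of_nonneg_left
        (mul_le_mul_of_nonneg_left hle (abs_nonneg (v₁ s))) hb.le]
  set F : ℝ := ⨆ t : Icc (0:ℝ) 2, |f t| with hF
  have hfF : ∀ t ∈ Icc (0:ℝ) 2, |f t| ≤ F := fun t ht => by
    have hbdd : BddAbove (range fun t : Icc (0:ℝ) 2 => |f t|) := by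
      have := (isCompact_Icc.image_of_continuousOn hf.abs).bddAbove
      rwa [image_eq_range] at this
    exact le_ciSup hbdd ⟨t, ht⟩
  have hF0 : 0 ≤ F := (abs_nonneg _).trans (hfF 0 (by simp))
  have hinner : ∀ t ∈ Icc (0:ℝ) 1, |∫ s in (0:ℝ)..1, G t s * f s| ≤ F / b := fun t ht => by
    have h := intervalIntegral.norm_integral_le_of_norm_le_const (a := 0) (b := 1)
      (f := fun s => G t s * f s) (C := F / b) fun s hs => by
        rw [uIoc_of_le zero_le_one] at hs
        rw [Real.norm_eq_abs, abs_mul, ← one_div_mul_eq_div]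
        exact mul_le_mul (hGb t ht s (Ioc_subset_Icc_self hs))
          (hfF s ⟨hs.1.le, by linarith [hs.2]⟩) (abs_nonneg _) (by positivity)
    simpa using h
  set K : ℝ := F + |δ| * (c + d) + (|β| + |δ|) * (b + c) + d * (F / b) with hK
  have hI0 : |∫ t in (0:ℝ)..1, deriv (fun y => G y t) 0 *
      (f (t + 1) - δ * (c + d * t) + (β - δ) * (b - c * t) -
        d * ∫ s in (0:ℝ)..1, G t s * f s)| ≤ 1 / ε * K := by
    have h := intervalIntegral.norm_integral_le_of_norm_le_const (a := 0) (b := 1)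
      (f := fun t => deriv (fun y => G y t) 0 *
        (f (t + 1) - δ * (c + d * t) + (β - δ) * (b - c * t) -
          d * ∫ s in (0:ℝ)..1, G t s * f s)) (C := 1 / ε * K) fun t ht => by
        rw [uIoc_of_le zero_le_one] at ht
        rw [Real.norm_eq_abs, abs_mul]
        refine mul_le_mul (hG0 t ht) ?_ (abs_nonneg _) (by positivity)
        refine (abs_sub _ _).trans (add_le_add ((abs_add_le _ _).trans
          (add_le_add ((abs_sub _ _).trans (add_le_add ?_ ?_)) ?_)) ?_)
        · exact hfF _ ⟨by linarith [ht.1], by linarith [ht.2]⟩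
        · rw [abs_mul]
          refine mul_le_mul_of_nonneg_left ?_ (abs_nonneg _)
          rw [abs_le]
          constructor <;> nlinarith [ht.1, ht.2]
        · rw [abs_mul]
          refine mul_le_mul (abs_sub _ _) ?_ (abs_nonneg _) (by positivity)
          rw [abs_le]
          constructor <;> nlinarith [ht.1, ht.2]
        · rw [abs_mul, abs_of_pos hd]
          exact mul_le_mul_of_nonneg_left (hinner t (Ioc_subset_Icc_self ht)) hd.le
    simpa using h
  have hI1 : |∫ t in (0:ℝ)..1, deriv (fun y => G y t) 1 * f t| ≤ 1 / ε * F := by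
    have hae : ∀ᵐ t : ℝ, t ∈ uIoc (0:ℝ) 1 →
        ‖deriv (fun y => G y t) 1 * f t‖ ≤ 1 / ε * F := by
      filter_upwards [MeasureTheory.Measure.ae_ne MeasureTheory.volume (1:ℝ)] with t ht1 ht
      rw [uIoc_of_le zero_le_one] at ht
      rw [Real.norm_eq_abs, abs_mul]
      exact mul_le_mul (hG1 t ⟨ht.1, lt_of_le_of_ne ht.2 ht1⟩)
        (hfF t ⟨ht.1.le, by linarith [ht.2]⟩) (abs_nonneg _) (by positivity)
    have h := intervalIntegral.norm_integral_le_of_norm_le_const_ae hae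
    simpa using h
  refine (abs_sub _ _).trans ((add_le_add ((abs_add_le _ _).trans
    (add_le_add (abs_sub β δ) hI0)) hI1).trans ?_)
  have hβ := abs_nonneg β
  have hδ := abs_nonneg δ
  have hdb : 0 < d / b := by positivity
  have hKF : K + F ≤ (3 + b + 2 * c + d + d / b) * (|β| + |δ| + F) := by
    rw [hK, show d * (F / b) = d / b * F by ring]
    have : 0 ≤ (3 + b + c + d + d / b) * |β| - b * |β| := by
      nlinarith [mul_nonneg hc.le hβ, mul_nonneg hd.le hβ, mul_nonneg hdb.le hβ]
    nlinarith [mul_nonneg hc.le hβ, mul_nonneg hδ hdb.le, mul_nonneg hb.le hF0,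
      mul_nonneg hc.le hF0, mul_nonneg hd.le hF0]
  have h1 : |β| + |δ| ≤ (3 + b + 2 * c + d + d / b) * (|β| + |δ|) :=
    le_mul_of_one_le_left (by positivity) (by linarith)
  have h2 := mul_le_mul_of_nonneg_left hKF (one_div_pos.2 hε).le
  calc |β| + |δ| + 1 / ε * K + 1 / ε * F
      = |β| + |δ| + 1 / ε * (K + F) := by ring
    _ ≤ _ := add_le_add h1 h2
    _ = _ := by ring
end
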